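/- arXiv:2004.09929 — 4 statements merged into one kernel-verified Lean document; each statement's English description precedes it below -/
import Mathlib

section
/- Let g > 0 and let f : ℝ → ℝ be a C⁴ function with f(t+1) = f(t) for all t. Then there exists α* ∈ ℝ such that for every real α > α* there exist sequences (tₙ)ₙ∈ℤ and (wₙ)ₙ∈ℤ of real numbers with t_{n+1} > tₙ for all n, satisfying the bouncing-ball recursion tₙ = t_{n-1} + (2/g)·w_{n-1} − (2/g)·(f(tₙ) − f(t_{n-1}))/(tₙ − t_{n-1}) + (2/g)·f′(t_{n-1}) and wₙ = w_{n-1} − 2·(f(tₙ) − f(t_{n-1}))/(tₙ − t_{n-1}) + f′(tₙ) + f′(t_{n-1}) for all n ∈ ℤ, and such that limₙ→∞ (1/n)·Σ_{k=0}^{n-1} (t_{k+1} − tₖ) = α. -/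
open Filter Topology

/-- The bouncing-ball recursion (equations (3) of the paper): `t` is the strictly
increasing sequence of impact times and `w` the sequence of post-impact relative
velocities, for gravity `g` and racket motion `f`. -/
def BouncingOrbit (g : ℝ) (f : ℝ → ℝ) (t w : ℤ → ℝ) : Prop :=
  (∀ n : ℤ, t n < t (n + 1)) ∧
  (∀ n : ℤ, t n = t (n - 1) + 2 / g * w (n - 1)
      - 2 / g * ((f (t n) - f (t (n - 1))) / (t n - t (n - 1)))
      + 2 / g * deriv f (t (n - 1))) ∧
  (∀ n : ℤ, w n = w (n - 1) - 2 * ((f (t n) - f (t (n - 1))) / (t n - t (n - 1)))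
      + deriv f (t n) + deriv f (t (n - 1)))

/-- The rotation number (mean time between bounces) of a sequence of impact times. -/
def HasRotNum (t : ℤ → ℝ) (α : ℝ) : Prop :=
  Tendsto (fun n : ℕ => (1 / (n : ℝ)) * ∑ k ∈ Finset.range n, (t ((k : ℤ) + 1) - t (k : ℤ)))
    atTop (𝓝 α)

open Set

/-- A generating function `h` on pairs at distance at least `A`, with partial derivatives
`d₁`, `d₂`, invariant under diagonal integer translations and submodular. -/
structure TwistGenerating (h d₁ d₂ : ℝ → ℝ → ℝ) (A : ℝ) : Prop where
  translate : ∀ (a b : ℝ) (m : ℤ), h (a + m) (b + m) = h a b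
  translate_fst : ∀ (a b : ℝ) (m : ℤ), d₁ (a + m) (b + m) = d₁ a b
  translate_snd : ∀ (a b : ℝ) (m : ℤ), d₂ (a + m) (b + m) = d₂ a b
  continuousOn : ContinuousOn (fun z : ℝ × ℝ => h z.1 z.2) {z | A ≤ z.2 - z.1}
  hasDerivAt : ∀ a b e e' : ℝ, A ≤ b - a →
    HasDerivAt (fun s : ℝ => h (a + s * e) (b + s * e')) (d₁ a b * e + d₂ a b * e') 0
  submodular : ∀ x y x' y' : ℝ, x ≤ y → y' ≤ x' → A ≤ y' - y →
    h x y' + h y x' ≤ h x x' + h y y'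

/-- Sequences with `x (n + q) = x n + p` whose deviation from the line of slope `α`
oscillates by at most `2`. -/
def NearLinear (q : ℕ) (p : ℤ) (α : ℝ) (x : ℤ → ℝ) : Prop :=
  (∀ n : ℤ, x (n + q) = x n + p) ∧ ∀ n m : ℤ, x n - x m ≤ ((n : ℝ) - m) * α + 2

/-- The action of a sequence over one period. -/
def periodAction (h : ℝ → ℝ → ℝ) (q : ℕ) (x : ℤ → ℝ) : ℝ :=
  ∑ i ∈ Finset.range q, h (x (i : ℤ)) (x ((i : ℤ) + 1))

theorem sum_range_shift_of_periodic {q : ℕ} {F : ℤ → ℝ} (hF : ∀ n, F (n + q) = F n) (a : ℤ) :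
    ∑ i ∈ Finset.range q, F ((i : ℤ) + a) = ∑ i ∈ Finset.range q, F (i : ℤ) := by
  have step : ∀ b : ℤ, ∑ i ∈ Finset.range q, F ((i : ℤ) + (b + 1))
      = ∑ i ∈ Finset.range q, F ((i : ℤ) + b) := by
    intro b
    have h1 := Finset.sum_range_succ (fun i : ℕ => F ((i : ℤ) + b)) q
    have h2 := Finset.sum_range_succ' (fun i : ℕ => F ((i : ℤ) + b)) q
    have h3 : F ((q : ℤ) + b) = F (((0 : ℕ) : ℤ) + b) := by
      rw [add_comm, hF]; simp
    have h4 : ∑ i ∈ Finset.range q, F ((i : ℤ) + (b + 1))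
        = ∑ i ∈ Finset.range q, F (((i + 1 : ℕ) : ℤ) + b) := by
      refine Finset.sum_congr rfl fun i _ => ?_
      congr 1; push_cast; ring
    rw [h4]; linarith
  induction a using Int.induction_on with
  | zero => simp
  | succ i ih => rw [step, ih]
  | pred i ih => rw [← ih, ← step]; simp

theorem eq_zero_of_periodic_of_sum_eq_zero {q : ℕ} (hq : 0 < q) {F : ℤ → ℝ}
    (hF : ∀ n, F (n + q) = F n) (h0 : ∀ n, 0 ≤ F n)
    (hs : ∑ i ∈ Finset.range q, F (i : ℤ) = 0) (n : ℤ) : F n = 0 := by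
  rw [← sum_range_shift_of_periodic hF n,
    Finset.sum_eq_zero_iff_of_nonneg (fun i _ => h0 _)] at hs
  simpa using hs 0 (Finset.mem_range.2 hq)

theorem bounded_of_periodic {q : ℕ} (hq : 0 < q) {F : ℤ → ℝ} (hF : ∀ n, F (n + q) = F n) :
    ∃ C, 0 < C ∧ ∀ n, |F n| ≤ C := by
  refine ⟨1 + ∑ i ∈ Finset.range q, |F (i : ℤ)|, by positivity, fun n => ?_⟩
  rw [← sum_range_shift_of_periodic (F := fun n => |F n|) (fun n => by simp only [hF]) n]
  have := Finset.single_le_sum (f := fun i : ℕ => |F ((i : ℤ) + n)|) (fun i _ => abs_nonneg _)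
    (Finset.mem_range.2 hq)
  simp only [Nat.cast_zero, zero_add] at this
  linarith

namespace NearLinear

variable {q : ℕ} {p : ℤ} {α : ℝ} {x y : ℤ → ℝ}

theorem gap (hx : NearLinear q p α x) (n : ℤ) : α - 2 ≤ x (n + 1) - x n := by
  have := hx.2 n (n + 1)
  push_cast at this
  linarith

theorem inf (hx : NearLinear q p α x) (hy : NearLinear q p α y) :
    NearLinear q p α (fun n => min (x n) (y n)) := by
  refine ⟨fun n => by simp only [hx.1, hy.1, min_add_add_right], fun n m => ?_⟩
  have h1 := hx.2 n m
  have h2 := hy.2 n m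
  rcases min_choice (x m) (y m) with h | h <;> simp only [h]
  · linarith [min_le_left (x n) (y n)]
  · linarith [min_le_right (x n) (y n)]

theorem sup (hx : NearLinear q p α x) (hy : NearLinear q p α y) :
    NearLinear q p α (fun n => max (x n) (y n)) := by
  refine ⟨fun n => by simp only [hx.1, hy.1, max_add_add_right], fun n m => ?_⟩
  have h1 := hx.2 n m
  have h2 := hy.2 n m
  rcases max_choice (x n) (y n) with h | h <;> simp only [h]
  · linarith [le_max_left (x m) (y m)]
  · linarith [le_max_right (x m) (y m)]

theorem translate (hx : NearLinear q p α x) (a b : ℤ) :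
    NearLinear q p α (fun n => x (n + a) + b) := by
  refine ⟨fun n => ?_, fun n m => ?_⟩
  · have := hx.1 (n + a)
    simp only
    rw [show n + (q : ℤ) + a = n + a + q by ring, this]; ring
  · have := hx.2 (n + a) (m + a)
    push_cast at this
    linarith

end NearLinear

namespace TwistGenerating

variable {h d₁ d₂ : ℝ → ℝ → ℝ} {A α : ℝ} {q : ℕ} {p : ℤ} {x y : ℤ → ℝ}

theorem periodAction_translate (H : TwistGenerating h d₁ d₂ A) (hx : NearLinear q p α x)
    (a b : ℤ) : periodAction h q (fun n => x (n + a) + b) = periodAction h q x := by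
  have hF : ∀ n : ℤ, h (x (n + q)) (x (n + q + 1)) = h (x n) (x (n + 1)) := by
    intro n
    rw [show n + (q : ℤ) + 1 = n + 1 + q by ring, hx.1, hx.1, H.translate]
  unfold periodAction
  rw [← sum_range_shift_of_periodic (F := fun n => h (x n) (x (n + 1))) hF a]
  refine Finset.sum_congr rfl fun i _ => ?_
  rw [H.translate, add_right_comm]

theorem min_add_max_le (H : TwistGenerating h d₁ d₂ A) {a b a' b' : ℝ} (ha : A ≤ a' - a)
    (hb : A ≤ b' - b) :
    h (min a b) (min a' b') + h (max a b) (max a' b') ≤ h a a' + h b b' := by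
  rcases le_total a b with h1 | h1 <;> rcases le_total a' b' with h2 | h2 <;>
    simp only [min_eq_left, min_eq_right, max_eq_left, max_eq_right, h1, h2]
  · exact le_rfl
  · exact H.submodular _ _ _ _ h1 h2 hb
  · linarith [H.submodular _ _ _ _ h1 h2 ha]
  · linarith

theorem periodAction_min_add_max_le (H : TwistGenerating h d₁ d₂ A) (hA : A ≤ α - 2)
    (hx : NearLinear q p α x) (hy : NearLinear q p α y) :
    periodAction h q (fun n => min (x n) (y n)) + periodAction h q (fun n => max (x n) (y n))
      ≤ periodAction h q x + periodAction h q y := by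
  unfold periodAction
  rw [← Finset.sum_add_distrib, ← Finset.sum_add_distrib]
  exact Finset.sum_le_sum fun i _ =>
    H.min_add_max_le (hA.trans (hx.gap _)) (hA.trans (hy.gap _))

/-- Near-linear sequences in the strip of height `5` above the line of slope `α`. -/
def strip (q : ℕ) (p : ℤ) (α : ℝ) : Set (ℤ → ℝ) :=
  {x | NearLinear q p α x ∧ ∀ n : ℤ, x n ∈ Icc (n * α) (n * α + 5)}

theorem isCompact_strip (q : ℕ) (p : ℤ) (α : ℝ) : IsCompact (strip q p α) := by
  have hc : IsCompact (Set.pi univ fun n : ℤ => Icc ((n : ℝ) * α) (n * α + 5)) :=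
    isCompact_univ_pi fun n => isCompact_Icc
  have hcl : IsClosed {x : ℤ → ℝ | NearLinear q p α x} := by
    simp only [NearLinear, ofPred_and, ofPred_forall]
    refine (isClosed_iInter fun n => ?_).inter
      (isClosed_iInter fun n => isClosed_iInter fun m => ?_)
    · exact isClosed_eq (by fun_prop) (by fun_prop)
    · exact isClosed_le (by fun_prop) (by fun_prop)
  refine (hc.inter_left hcl).of_isClosed_subset ?_ ?_
  · have : strip q p α = {x : ℤ → ℝ | NearLinear q p α x} ∩
        Set.pi univ fun n : ℤ => Icc ((n : ℝ) * α) (n * α + 5) := by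
      ext x
      simp only [strip, mem_ofPred_eq, mem_inter_iff, mem_univ_pi]
    rw [this]
    exact hcl.inter hc.isClosed
  · intro x hx
    exact ⟨hx.1, fun n _ => hx.2 n⟩

theorem continuousOn_periodAction (H : TwistGenerating h d₁ d₂ A) (hA : A ≤ α - 2) :
    ContinuousOn (periodAction h q) (strip q p α) := by
  unfold periodAction
  refine continuousOn_finsetSum _ fun i _ => ?_
  exact H.continuousOn.comp (f := fun x : ℤ → ℝ => (x (i : ℤ), x ((i : ℤ) + 1)))
    (by fun_prop) fun x hx => hA.trans (hx.1.gap _)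

theorem strip_nonempty (hα : α * q = p) : (strip q p α).Nonempty := by
  refine ⟨fun n => n * α, ⟨fun n => ?_, fun n m => ?_⟩, fun n => ⟨le_rfl, by linarith⟩⟩
  · push_cast; rw [← hα]; ring
  · linarith

theorem exists_translate_mem_strip (hx : NearLinear q p α x) :
    ∃ b : ℤ, (fun n => x (n + 0) + (b : ℝ)) ∈ strip q p α := by
  refine ⟨2 - ⌊x 0⌋, hx.translate 0 _, fun n => ?_⟩
  have h1 := hx.2 n 0
  have h2 := hx.2 0 n
  have h3 := Int.floor_le (x 0)
  have h4 := Int.lt_floor_add_one (x 0)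
  push_cast at h1 h2 ⊢
  rw [add_zero]
  constructor <;> linarith

/-- There is an action minimizer whose deviation from the line oscillates by at most `1`. -/
theorem exists_minimizer (H : TwistGenerating h d₁ d₂ A) (hA : A ≤ α - 2) (hq : 0 < q)
    (hα : α * q = p) :
    ∃ x ∈ strip q p α, (∀ y, NearLinear q p α y → periodAction h q x ≤ periodAction h q y) ∧
      ∀ n m : ℤ, x n - x m ≤ ((n : ℝ) - m) * α + 1 := by
  obtain ⟨x₀, hx₀, hmin⟩ := (isCompact_strip q p α).exists_isMinOn (strip_nonempty hα)
    (H.continuousOn_periodAction hA)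
  have hmin' : ∀ y, NearLinear q p α y → periodAction h q x₀ ≤ periodAction h q y := by
    intro y hy
    obtain ⟨b, hb⟩ := exists_translate_mem_strip hy
    rw [← H.periodAction_translate hy 0 b]
    exact hmin hb
  have hMc : IsCompact (strip q p α ∩ periodAction h q ⁻¹' {periodAction h q x₀}) :=
    (isCompact_strip q p α).of_isClosed_subset
      ((H.continuousOn_periodAction hA).preimage_isClosed_of_isClosed
        (isCompact_strip q p α).isClosed isClosed_singleton) inter_subset_left
  obtain ⟨x, ⟨hx, hxW⟩, hxmin⟩ := hMc.exists_isMinOn ⟨x₀, hx₀, rfl⟩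
    (f := fun x : ℤ → ℝ => ∑ i ∈ Finset.range q, x (i : ℤ)) (by fun_prop)
  simp only [mem_preimage, mem_singleton_iff] at hxW
  refine ⟨x, hx, fun y hy => hxW ▸ hmin' y hy, ?_⟩
  have key : ∀ (a b : ℤ) (n : ℤ), 0 ≤ b + a * α → x n ≤ x (n + a) + b := by
    intro a b n hab
    have hy := hx.1.translate a b
    have hz := hx.1.inf hy
    have hW := H.periodAction_min_add_max_le hA hx.1 hy
    rw [H.periodAction_translate hx.1] at hW
    have h1 := hmin' _ (hx.1.sup hy)
    have h2 := hmin' _ hz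
    have hzs : (fun n => min (x n) (x (n + a) + b)) ∈ strip q p α := by
      refine ⟨hz, fun k => ⟨le_min (hx.2 k).1 ?_, (min_le_left _ _).trans (hx.2 k).2⟩⟩
      have := (hx.2 (k + a)).1
      push_cast at this
      linarith
    have h3 : ∑ i ∈ Finset.range q, x (i : ℤ)
        ≤ ∑ i ∈ Finset.range q, min (x (i : ℤ)) (x ((i : ℤ) + a) + b) :=
      hxmin ⟨hzs, by simp only [mem_preimage, mem_singleton_iff]; linarith⟩
    have h4 : ∑ i ∈ Finset.range q, (x (i : ℤ) - min (x (i : ℤ)) (x ((i : ℤ) + a) + b)) = 0 := by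
      refine le_antisymm ?_ (Finset.sum_nonneg fun i _ => sub_nonneg.2 (min_le_left _ _))
      rw [Finset.sum_sub_distrib]; linarith
    have h5 := eq_zero_of_periodic_of_sum_eq_zero hq
      (F := fun n => x n - min (x n) (x (n + a) + b))
      (fun n => by linarith [hz.1 n, hx.1.1 n])
      (fun n => sub_nonneg.2 (min_le_left _ _)) h4 n
    linarith [min_le_right (x n) (x (n + a) + b)]
  intro n m
  have h1 := key (m - n) ⌈((n : ℝ) - m) * α⌉ n (by
    have := Int.le_ceil (((n : ℝ) - m) * α)
    push_cast; linarith)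
  have h2 := Int.ceil_lt_add_one (((n : ℝ) - m) * α)
  rw [show n + (m - n) = m by ring] at h1
  linarith

theorem stationary_of_minimizer (H : TwistGenerating h d₁ d₂ A) (hA : A ≤ α - 2) (hq : 0 < q)
    (hx : NearLinear q p α x)
    (hmin : ∀ y, NearLinear q p α y → periodAction h q x ≤ periodAction h q y)
    (hosc : ∀ n m : ℤ, x n - x m ≤ ((n : ℝ) - m) * α + 1) (n : ℤ) :
    d₁ (x n) (x (n + 1)) + d₂ (x (n - 1)) (x n) = 0 := by
  set e : ℤ → ℝ := fun n => d₁ (x n) (x (n + 1)) + d₂ (x (n - 1)) (x n) with he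
  have heper : ∀ n, e (n + q) = e n := by
    intro n
    simp only [he]
    rw [show n + (q : ℤ) + 1 = n + 1 + q by ring, show n + (q : ℤ) - 1 = n - 1 + q by ring,
      hx.1, hx.1, hx.1, H.translate_fst, H.translate_snd]
  obtain ⟨C, hC, heC⟩ := bounded_of_periodic hq heper
  have hder : HasDerivAt (fun s : ℝ => periodAction h q (fun n => x n + s * e n))
      (∑ i ∈ Finset.range q, (d₁ (x (i : ℤ)) (x ((i : ℤ) + 1)) * e i
        + d₂ (x (i : ℤ)) (x ((i : ℤ) + 1)) * e ((i : ℤ) + 1))) 0 := by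
    unfold periodAction
    exact HasDerivAt.fun_sum fun i _ => H.hasDerivAt _ _ _ _ (hA.trans (hx.gap _))
  have hloc : IsLocalMin (fun s : ℝ => periodAction h q (fun n => x n + s * e n)) 0 := by
    have hs : ∀ᶠ s : ℝ in 𝓝 0, |s| < 1 / (2 * C) := by
      have : Tendsto (fun s : ℝ => |s|) (𝓝 0) (𝓝 0) := by
        simpa using (continuous_abs (G := ℝ)).tendsto 0
      exact this.eventually (gt_mem_nhds (by positivity))
    filter_upwards [hs] with s hs
    simp only [zero_mul, add_zero]
    refine hmin _ ⟨fun n => ?_, fun n m => ?_⟩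
    · simp only [hx.1, heper]; ring
    · have hb : ∀ k, |s * e k| ≤ 1 / 2 := by
        intro k
        rw [abs_mul]
        calc |s| * |e k| ≤ 1 / (2 * C) * C := by
              gcongr
              exact heC k
          _ = 1 / 2 := by field_simp
      have h1 := abs_le.1 (hb n)
      have h2 := abs_le.1 (hb m)
      linarith [hosc n m]
  have h0 := hloc.hasDerivAt_eq_zero hder
  have hper2 : ∀ n : ℤ, d₂ (x (n + q - 1)) (x (n + q)) * e (n + q)
      = d₂ (x (n - 1)) (x n) * e n := by
    intro n
    rw [show n + (q : ℤ) - 1 = n - 1 + q by ring, hx.1, hx.1, H.translate_snd, heper]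
  have hshift := sum_range_shift_of_periodic
    (F := fun n => d₂ (x (n - 1)) (x n) * e n) hper2 1
  simp only [add_sub_cancel_right] at hshift
  rw [Finset.sum_add_distrib, hshift, ← Finset.sum_add_distrib] at h0
  have h1 := eq_zero_of_periodic_of_sum_eq_zero hq (F := fun n => e n * e n)
    (fun n => by simp only [heper]) (fun n => mul_self_nonneg _)
    (by rw [← h0]; exact Finset.sum_congr rfl fun i _ => by simp only [he]; ring) n
  exact mul_self_eq_zero.1 h1

/-- Existence of a stationary sequence with rational mean gap `α = p / q`. -/
theorem exists_stationary (H : TwistGenerating h d₁ d₂ A) (hA : A ≤ α - 2) (hq : 0 < q)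
    (hα : α * q = p) :
    ∃ x : ℤ → ℝ, (∀ n : ℤ, x n ∈ Icc (n * α) (n * α + 5)) ∧
      (∀ n, α - 2 ≤ x (n + 1) - x n) ∧
      ∀ n, d₁ (x n) (x (n + 1)) + d₂ (x (n - 1)) (x n) = 0 := by
  obtain ⟨x, hx, hmin, hosc⟩ := H.exists_minimizer hA hq hα
  exact ⟨x, hx.2, hx.1.gap, H.stationary_of_minimizer hA hq hx.1 hmin hosc⟩

/-- Existence of a stationary sequence with arbitrary mean gap `α`, as a limit of stationary
sequences with rational mean gaps. -/
theorem exists_stationary_real (H : TwistGenerating h d₁ d₂ A) (hA : A ≤ α - 3)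
    {E : ℝ → ℝ → ℝ → ℝ}
    (hE : ∀ a b c, A ≤ b - a → A ≤ c - b → d₁ b c + d₂ a b = 0 → E a b c = 0)
    (hEc : ContinuousOn (fun z : ℝ × ℝ × ℝ => E z.1 z.2.1 z.2.2)
      {z | A ≤ z.2.1 - z.1 ∧ A ≤ z.2.2 - z.2.1}) :
    ∃ x : ℤ → ℝ, (∀ n : ℤ, x n ∈ Icc (n * α) (n * α + 5)) ∧
      (∀ n, A ≤ x (n + 1) - x n) ∧ ∀ n, E (x (n - 1)) (x n) (x (n + 1)) = 0 := by
  set β : ℕ → ℝ := fun k => ⌊α * (k + 1 : ℕ)⌋ / (k + 1 : ℕ) with hβ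
  have hβ1 : ∀ k, |β k - α| ≤ 1 / ((k : ℝ) + 1) := by
    intro k
    have hk : (0 : ℝ) < (k : ℝ) + 1 := by positivity
    have h1 := Int.floor_le (α * (k + 1 : ℕ))
    have h2 := Int.lt_floor_add_one (α * (k + 1 : ℕ))
    have h3 : β k - α = (⌊α * (k + 1 : ℕ)⌋ - α * (k + 1 : ℕ)) / ((k : ℝ) + 1) := by
      simp only [hβ]; push_cast; field_simp
    rw [h3, abs_div, abs_of_pos hk]
    gcongr
    rw [abs_le]; constructor <;> linarith
  have hβ2 : ∀ k, |β k - α| ≤ 1 := fun k => (hβ1 k).trans (by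
    rw [div_le_one (by positivity)]; linarith [(Nat.cast_nonneg k : (0 : ℝ) ≤ k)])
  have hβlim : Tendsto β atTop (𝓝 α) := by
    rw [tendsto_iff_norm_sub_tendsto_zero]
    exact squeeze_zero (fun k => norm_nonneg _) hβ1 tendsto_one_div_add_atTop_nhds_zero_nat
  have hA' : ∀ k, A ≤ β k - 2 := fun k => by linarith [(abs_le.1 (hβ2 k)).1]
  choose x hxI hxg hxs using fun k : ℕ => H.exists_stationary (q := k + 1)
    (p := ⌊α * (k + 1 : ℕ)⌋) (hA' k) k.succ_pos
    (by simp only [hβ]; field_simp)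
  have hc : IsCompact (Set.pi univ fun n : ℤ => Icc (n * α - |(n : ℝ)|) (n * α + |(n : ℝ)| + 5)) :=
    isCompact_univ_pi fun n => isCompact_Icc
  have hmem : ∀ k, x k ∈ Set.pi univ
      fun n : ℤ => Icc (n * α - |(n : ℝ)|) (n * α + |(n : ℝ)| + 5) := by
    intro k n _
    have h1 : |(n : ℝ) * (β k - α)| ≤ |(n : ℝ)| := by
      rw [abs_mul]; exact mul_le_of_le_one_right (abs_nonneg _) (hβ2 k)
    have h2 := abs_le.1 h1
    have h3 := hxI k n
    constructor <;> nlinarith [h3.1, h3.2]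
  obtain ⟨X, -, φ, hφ, hlim⟩ := hc.tendsto_subseq hmem
  have hX : ∀ n, Tendsto (fun k => x (φ k) n) atTop (𝓝 (X n)) := tendsto_pi_nhds.1 hlim
  have hβφ : Tendsto (fun k => β (φ k)) atTop (𝓝 α) := hβlim.comp hφ.tendsto_atTop
  have hgap : ∀ n, A ≤ X (n + 1) - X n := fun n =>
    ge_of_tendsto' ((hX _).sub (hX _)) fun k => (hA' _).trans (hxg _ n)
  refine ⟨X, fun n => ⟨?_, ?_⟩, hgap, fun n => ?_⟩
  · exact le_of_tendsto_of_tendsto' (hβφ.const_mul _) (hX n) fun k => (hxI _ n).1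
  · exact le_of_tendsto_of_tendsto' (hX n) ((hβφ.const_mul _).add_const _)
      fun k => (hxI _ n).2
  · have hg' : ∀ y : ℤ → ℝ, (∀ n, A ≤ y (n + 1) - y n) →
        (y (n - 1), y n, y (n + 1)) ∈ {z : ℝ × ℝ × ℝ | A ≤ z.2.1 - z.1 ∧ A ≤ z.2.2 - z.2.1} := by
      intro y hy
      have := hy (n - 1)
      rw [sub_add_cancel] at this
      exact ⟨this, hy n⟩
    have hxg' := fun k => hg' (x (φ k)) fun n => (hA' _).trans (hxg (φ k) n)
    have ht : Tendsto (fun k => (x (φ k) (n - 1), x (φ k) n, x (φ k) (n + 1))) atTop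
        (𝓝[{z : ℝ × ℝ × ℝ | A ≤ z.2.1 - z.1 ∧ A ≤ z.2.2 - z.2.1}]
          (X (n - 1), X n, X (n + 1))) :=
      tendsto_nhdsWithin_iff.2 ⟨(hX _).prodMk_nhds ((hX _).prodMk_nhds (hX _)),
        Eventually.of_forall hxg'⟩
    have h1 := (hEc _ (hg' X hgap)).tendsto.comp ht
    have h2 : (fun z : ℝ × ℝ × ℝ => E z.1 z.2.1 z.2.2) ∘
        (fun k => (x (φ k) (n - 1), x (φ k) n, x (φ k) (n + 1))) = fun _ => 0 := by
      funext k
      exact hE _ _ _ (hxg' k).1 (hxg' k).2 (hxs _ n)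
    rw [h2] at h1
    exact tendsto_nhds_unique h1 tendsto_const_nhds

end TwistGenerating

/-- The relative velocity just after a bounce at time `a` when the next bounce is at time `b`. -/
noncomputable def postVelocity (g : ℝ) (f : ℝ → ℝ) (a b : ℝ) : ℝ :=
  g / 2 * (b - a) + (f b - f a) / (b - a) - deriv f a

/-- The relative velocity, with reversed sign, just before a bounce at time `b` when the previous
bounce is at time `a`. -/
noncomputable def preVelocity (g : ℝ) (f : ℝ → ℝ) (a b : ℝ) : ℝ :=
  g / 2 * (b - a) - (f b - f a) / (b - a) + deriv f b

/-- Minus the action of a flight between bounces at times `a` and `b`. -/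
noncomputable def flightAction (g : ℝ) (f : ℝ → ℝ) (a b : ℝ) : ℝ :=
  g ^ 2 / 24 * (b - a) ^ 3 + g / 2 * ((b - a) * (f a + f b)) - (f b - f a) ^ 2 / (2 * (b - a))

/-- Partial derivative of `flightAction` in the first time. -/
noncomputable def flightActionFst (g : ℝ) (f : ℝ → ℝ) (a b : ℝ) : ℝ :=
  -(postVelocity g f a b) ^ 2 / 2 + (deriv f a) ^ 2 / 2 - g * f a

/-- Partial derivative of `flightAction` in the second time. -/
noncomputable def flightActionSnd (g : ℝ) (f : ℝ → ℝ) (a b : ℝ) : ℝ :=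
  (preVelocity g f a b) ^ 2 / 2 - (deriv f b) ^ 2 / 2 + g * f b

section BouncingBall

variable {g : ℝ} {f : ℝ → ℝ} {L A : ℝ}

theorem hasDerivAt_flightAction (hf : Differentiable ℝ f) {a b : ℝ} (hab : 0 < b - a)
    (e e' : ℝ) :
    HasDerivAt (fun s : ℝ => flightAction g f (a + s * e) (b + s * e'))
      (flightActionFst g f a b * e + flightActionSnd g f a b * e') 0 := by
  have line : ∀ c d : ℝ, HasDerivAt (fun s : ℝ => c + s * d) d 0 := fun c d => by
    simpa using ((hasDerivAt_id (0 : ℝ)).mul_const d).const_add c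
  have hline : ∀ c d : ℝ, HasDerivAt (fun s : ℝ => f (c + s * d)) (deriv f c * d) 0 := by
    intro c d
    refine HasDerivAt.comp (0 : ℝ) (h₂ := f) ?_ (line c d)
    simpa using (hf c).hasDerivAt
  have hT := (line b e').sub (line a e)
  have hD := (hline b e').sub (hline a e)
  have hS := (hline a e).add (hline b e')
  have hne : (2 * ((fun s : ℝ => b + s * e') - fun s : ℝ => a + s * e) 0) ≠ 0 := by
    simp only [Pi.sub_apply, zero_mul, add_zero]
    exact (mul_pos two_pos hab).ne'
  have := (((hT.pow 3).const_mul (g ^ 2 / 24)).add ((hT.mul hS).const_mul (g / 2))).sub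
    ((hD.pow 2).div (hT.const_mul 2) hne)
  refine this.congr_deriv ?_
  simp only [flightActionFst, flightActionSnd, postVelocity, preVelocity, Pi.sub_apply,
    Pi.add_apply, Pi.pow_apply, zero_mul, add_zero]
  have : b - a ≠ 0 := hab.ne'
  field_simp
  ring

theorem abs_sub_le_of_abs_deriv_le (hf : Differentiable ℝ f) (hL : ∀ t, |deriv f t| ≤ L)
    {a b : ℝ} (hab : a ≤ b) : |f b - f a| ≤ L * (b - a) := by
  have := convex_univ.norm_image_sub_le_of_norm_deriv_le (f := f) (𝕜 := ℝ) (C := L)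
    (fun t _ => hf t) (fun t _ => hL t) (mem_univ a) (mem_univ b)
  simpa [Real.norm_eq_abs, abs_of_nonneg (sub_nonneg.2 hab)] using this

theorem abs_slope_le (hf : Differentiable ℝ f) (hL : ∀ t, |deriv f t| ≤ L)
    {a b : ℝ} (hab : 0 < b - a) : |(f b - f a) / (b - a)| ≤ L := by
  rw [abs_div, abs_of_pos hab, div_le_iff₀ hab]
  exact abs_sub_le_of_abs_deriv_le hf hL (by linarith)

theorem postVelocity_pos (hg : 0 < g) (hf : Differentiable ℝ f) (hL : ∀ t, |deriv f t| ≤ L)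
    (hA0 : 0 < A) (hA : 4 * L < g * A) {a b : ℝ} (hab : A ≤ b - a) :
    0 < postVelocity g f a b := by
  have h1 := abs_le.1 (abs_slope_le hf hL (hA0.trans_le hab))
  have h2 := abs_le.1 (hL a)
  unfold postVelocity
  nlinarith

theorem preVelocity_pos (hg : 0 < g) (hf : Differentiable ℝ f) (hL : ∀ t, |deriv f t| ≤ L)
    (hA0 : 0 < A) (hA : 4 * L < g * A) {a b : ℝ} (hab : A ≤ b - a) :
    0 < preVelocity g f a b := by
  have h1 := abs_le.1 (abs_slope_le hf hL (hA0.trans_le hab))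
  have h2 := abs_le.1 (hL b)
  unfold preVelocity
  nlinarith

theorem postVelocity_mono (hg : 0 < g) (hf : Differentiable ℝ f) (hL : ∀ t, |deriv f t| ≤ L)
    (hA0 : 0 < A) (hA : 4 * L < g * A) {a b c : ℝ} (hab : A ≤ b - a) (hbc : b ≤ c) :
    postVelocity g f a b ≤ postVelocity g f a c := by
  have hb : 0 < b - a := hA0.trans_le hab
  have hc : 0 < c - a := by linarith
  have h1 := abs_le.1 (abs_slope_le hf hL hb)
  have h2 := abs_le.1 (abs_sub_le_of_abs_deriv_le hf hL hbc)
  have hslope : (f c - f a) / (c - a) - (f b - f a) / (b - a)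
      = ((f c - f b) - (f b - f a) / (b - a) * (c - b)) / (c - a) := by
    field_simp; ring
  have h3 : -(g / 2 * (c - b)) ≤ (f c - f a) / (c - a) - (f b - f a) / (b - a) := by
    rw [hslope, le_div_iff₀ hc]
    have h4 : (f b - f a) / (b - a) * (c - b) ≤ L * (c - b) :=
      mul_le_mul_of_nonneg_right h1.2 (by linarith)
    have h5 : 4 * L * (c - b) ≤ g * (c - a) * (c - b) :=
      mul_le_mul_of_nonneg_right (by nlinarith) (by linarith)
    linarith
  unfold postVelocity
  linarith

theorem twistGenerating_flightAction (hg : 0 < g) (hf : ContDiff ℝ 1 f)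
    (hper : Function.Periodic f 1) (hL : ∀ t, |deriv f t| ≤ L) (hA0 : 0 < A)
    (hA : 4 * L < g * A) :
    TwistGenerating (flightAction g f) (flightActionFst g f) (flightActionSnd g f) A := by
  have hfd : Differentiable ℝ f := hf.differentiable one_ne_zero
  have hfc : Continuous f := hf.continuous
  have hf1 : ∀ (t : ℝ) (m : ℤ), f (t + m) = f t := fun t m => by
    simpa using hper.int_mul m t
  have hf2 : ∀ (t : ℝ) (m : ℤ), deriv f (t + m) = deriv f t := fun t m => by
    rw [← deriv_comp_add_const]
    simp only [hf1]
  refine ⟨fun a b m => ?_, fun a b m => ?_, fun a b m => ?_, ?_, fun a b e e' hab => ?_,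
    fun x y x' y' hxy hyx' hgap => ?_⟩
  · simp only [flightAction, hf1, add_sub_add_right_eq_sub]
  · simp only [flightActionFst, postVelocity, hf1, hf2, add_sub_add_right_eq_sub]
  · simp only [flightActionSnd, preVelocity, hf1, hf2, add_sub_add_right_eq_sub]
  · unfold flightAction
    refine ContinuousOn.sub (by fun_prop) (ContinuousOn.div (by fun_prop) (by fun_prop) ?_)
    intro z hz
    have : A ≤ z.2 - z.1 := hz
    linarith
  · exact hasDerivAt_flightAction hfd (hA0.trans_le hab) e e'
  · have hd : ∀ s c : ℝ, A ≤ c - s → HasDerivAt (fun s => flightAction g f s c)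
        (flightActionFst g f s c) s := by
      intro s c hsc
      have h1 := hasDerivAt_flightAction (g := g) hfd (hA0.trans_le hsc) 1 0
      simp only [mul_one, mul_zero, add_zero] at h1
      have h2 := HasDerivAt.comp_sub_const (x := s) (a := s)
        (f := fun r => flightAction g f (s + r) c) (by simpa using h1)
      simpa using h2
    have hdG : ∀ s ≤ y, HasDerivAt (fun s => flightAction g f s x' - flightAction g f s y')
        (flightActionFst g f s x' - flightActionFst g f s y') s := fun s hs =>
      (hd s x' (by linarith)).sub (hd s y' (by linarith))
    have hanti : AntitoneOn (fun s => flightAction g f s x' - flightAction g f s y') (Iic y) := by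
      refine antitoneOn_of_deriv_nonpos (convex_Iic y)
        (fun s hs => (hdG s hs).continuousAt.continuousWithinAt)
        (fun s hs => (hdG s (interior_subset (s := Iic y) hs)).differentiableAt.differentiableWithinAt)
        fun s hs => ?_
      have hs' : s ≤ y := interior_subset (s := Iic y) hs
      rw [(hdG s hs').deriv]
      have h1 : A ≤ y' - s := by linarith
      have h2 := postVelocity_pos hg hfd hL hA0 hA h1
      have h3 := postVelocity_mono hg hfd hL hA0 hA h1 hyx'
      have h4 := pow_le_pow_left₀ h2.le h3 2
      unfold flightActionFst
      linarith
    have := hanti (mem_Iic.2 hxy) (mem_Iic.2 le_rfl) hxy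
    simp only at this
    linarith

theorem hasRotNum_of_mem_Icc {t : ℤ → ℝ} {α C : ℝ}
    (ht : ∀ n : ℤ, t n ∈ Icc (n * α) (n * α + C)) : HasRotNum t α := by
  unfold HasRotNum
  have hsum : ∀ n : ℕ, ∑ k ∈ Finset.range n, (t ((k : ℤ) + 1) - t (k : ℤ)) = t n - t 0 := by
    intro n
    simpa using Finset.sum_range_sub (fun k : ℕ => t (k : ℤ)) n
  rw [tendsto_iff_norm_sub_tendsto_zero]
  refine squeeze_zero' (Eventually.of_forall fun n => norm_nonneg _) ?_
    (tendsto_const_div_atTop_nhds_zero_nat C)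
  filter_upwards [eventually_gt_atTop 0] with n hn
  have hn' : (0 : ℝ) < n := by exact_mod_cast hn
  have h1 : 1 / (n : ℝ) * (t n - t 0) - α = (t n - t 0 - n * α) / n := by field_simp
  rw [hsum, h1, Real.norm_eq_abs, abs_div, abs_of_pos hn']
  gcongr
  have h2 := ht n
  have h3 := ht 0
  simp only [Int.cast_natCast, Int.cast_zero, zero_mul, zero_add, mem_Icc] at h2 h3
  rw [abs_le]
  constructor <;> linarith [h2.1, h2.2, h3.1, h3.2]

theorem bouncingOrbit_of_velocity_eq (hg : 0 < g) {t : ℤ → ℝ} (ht : ∀ n, t n < t (n + 1))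
    (hv : ∀ n, postVelocity g f (t n) (t (n + 1)) - preVelocity g f (t (n - 1)) (t n) = 0) :
    BouncingOrbit g f t (fun n => postVelocity g f (t n) (t (n + 1))) := by
  refine ⟨ht, fun n => ?_, fun n => ?_⟩
  · simp only [postVelocity, sub_add_cancel]
    generalize (f (t n) - f (t (n - 1))) / (t n - t (n - 1)) = S
    field_simp
    ring
  · simp only
    have h1 := hv n
    rw [sub_eq_zero.1 h1]
    simp only [preVelocity, postVelocity, sub_add_cancel]
    ring

end BouncingBall

theorem bounded_orbits_with_prescribed_rotation_number
    (g : ℝ) (hg : 0 < g) (f : ℝ → ℝ) (hf : ContDiff ℝ 4 f)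
    (hper : ∀ t : ℝ, f (t + 1) = f t) :
    ∃ αstar : ℝ, ∀ α : ℝ, αstar < α →
      ∃ t w : ℤ → ℝ, BouncingOrbit g f t w ∧ HasRotNum t α := by
  have hf1 : ContDiff ℝ 1 f := hf.of_le (by norm_num)
  have hfd : Differentiable ℝ f := hf1.differentiable one_ne_zero
  have hfc : Continuous f := hf1.continuous
  have hdc : Continuous (deriv f) := hf1.continuous_deriv le_rfl
  have hdper : Function.Periodic (deriv f) 1 := fun t => by
    rw [← deriv_comp_add_const]
    simp only [hper]
  obtain ⟨L, hL⟩ := (hdper.isBounded_of_continuous one_ne_zero hdc).exists_norm_le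
  have hL : ∀ t, |deriv f t| ≤ L := fun t => hL _ (mem_range_self t)
  have hL0 : 0 ≤ L := (abs_nonneg _).trans (hL 0)
  set A : ℝ := (4 * L + 1) / g with hAdef
  have hA0 : 0 < A := by positivity
  have hA : 4 * L < g * A := by
    rw [hAdef, mul_div_cancel₀ _ hg.ne']; linarith
  refine ⟨A + 3, fun α hα => ?_⟩
  have H := twistGenerating_flightAction hg hf1 hper hL hA0 hA
  obtain ⟨t, htI, htg, htE⟩ := H.exists_stationary_real (α := α) (by linarith)
    (E := fun a b c => postVelocity g f b c - preVelocity g f a b)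
    (fun a b c hab hbc hs => by
      have h1 := postVelocity_pos hg hfd hL hA0 hA hbc
      have h2 := preVelocity_pos hg hfd hL hA0 hA hab
      simp only [flightActionFst, flightActionSnd] at hs
      rw [sub_eq_zero, ← sq_eq_sq₀ h1.le h2.le]
      linarith)
    (by
      unfold postVelocity preVelocity
      refine ContinuousOn.sub
        (((ContinuousOn.add (by fun_prop) (ContinuousOn.div (by fun_prop) (by fun_prop) ?_))).sub
          (by fun_prop))
        (((ContinuousOn.sub (by fun_prop) (ContinuousOn.div (by fun_prop) (by fun_prop) ?_))).add
          (by fun_prop))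
      · intro z hz
        exact (hA0.trans_le hz.2).ne'
      · intro z hz
        exact (hA0.trans_le hz.1).ne')
  exact ⟨t, _, bouncingOrbit_of_velocity_eq hg (fun n => by linarith [htg n]) htE,
    hasRotNum_of_mem_Icc htI⟩
end

section
/- Let g > 0 and let f : ℝ → ℝ be a C⁴ function with f(t+1) = f(t) for all t. Define F(t₀, t₁, w₀) = t₁ − t₀ − (2/g)·w₀ + (2/g)·(f(t₁) − f(t₀))/(t₁ − t₀) − (2/g)·f′(t₀) for t₁ > t₀. Then the partial derivative of F with respect to t₁ equals 1 + 2·(f′(t₁)·(t₁ − t₀) − f(t₁) + f(t₀))/(g·(t₁ − t₀)²), and there exists K > 0 such that this quantity is ≥ 1/2 (in particular strictly positive) whenever t₁ − t₀ ≥ K. -/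
/-- A continuous periodic real function is bounded. -/
theorem Function.Periodic.exists_abs_le_of_continuous {f : ℝ → ℝ} {c : ℝ}
    (hp : Function.Periodic f c) (hc : c ≠ 0) (hf : Continuous f) :
    ∃ C, 0 ≤ C ∧ ∀ t, |f t| ≤ C := by
  obtain ⟨C, hC⟩ := (hp.isBounded_of_continuous hc hf).exists_norm_le
  have h : ∀ t, |f t| ≤ C := fun t => hC _ ⟨t, rfl⟩
  exact ⟨C, (abs_nonneg _).trans (h 0), h⟩

/-- The derivative in `t₁` of the defining function
`F(t₀, t₁, w₀) = t₁ - t₀ - (2/g)w₀ + (2/g)(f(t₁)-f(t₀))/(t₁-t₀) - (2/g)f'(t₀)`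
equals `1 + 2(f'(t₁)(t₁-t₀) - f(t₁) + f(t₀))/(g(t₁-t₀)²)`, and this quantity is `≥ 1/2`
once `t₁ - t₀` is large enough. -/
theorem derivative_of_implicit_function_positive
    (g : ℝ) (hg : 0 < g) (f : ℝ → ℝ) (hf : ContDiff ℝ 4 f)
    (hper : ∀ t : ℝ, f (t + 1) = f t) :
    (∀ t0 w0 t1 : ℝ, t0 < t1 →
      HasDerivAt
        (fun s : ℝ => s - t0 - 2 / g * w0 + 2 / g * ((f s - f t0) / (s - t0))
          - 2 / g * deriv f t0)
        (1 + 2 * (deriv f t1 * (t1 - t0) - f t1 + f t0) / (g * (t1 - t0) ^ 2)) t1) ∧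
    ∃ K : ℝ, 0 < K ∧ ∀ t0 t1 : ℝ, K ≤ t1 - t0 →
      (1 / 2 : ℝ) ≤ 1 + 2 * (deriv f t1 * (t1 - t0) - f t1 + f t0) / (g * (t1 - t0) ^ 2) := by
  have hd : Differentiable ℝ f := hf.differentiable (by norm_num)
  refine ⟨fun t0 w0 t1 h => ?_, ?_⟩
  · have hne : t1 - t0 ≠ 0 := (sub_pos.2 h).ne'
    have hs : HasDerivAt (fun s : ℝ => s - t0) 1 t1 := (hasDerivAt_id t1).sub_const t0
    have hq := (((hd t1).hasDerivAt.sub_const (f t0)).div hs hne).const_mul (2 / g)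
    refine (((hs.sub_const (2 / g * w0)).add hq).sub_const (2 / g * deriv f t0)).congr_deriv ?_
    field_simp
    ring
  · have hper' : Function.Periodic (deriv f) 1 := fun t => by
      rw [← deriv_comp_add_const, funext hper]
    obtain ⟨M, hM0, hM⟩ :=
      Function.Periodic.exists_abs_le_of_continuous hper one_ne_zero hf.continuous
    obtain ⟨D, hD0, hD⟩ :=
      hper'.exists_abs_le_of_continuous one_ne_zero (hf.continuous_deriv (by norm_num))
    refine ⟨1 + 4 * (D + 2 * M) / g, by positivity, fun t0 t1 h => ?_⟩
    set d := t1 - t0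
    have hd1 : 1 ≤ d := le_trans (le_add_of_nonneg_right (by positivity)) h
    have hgd : 4 * (D + 2 * M) ≤ d * g := (div_le_iff₀ hg).1 (by linarith)
    have hnum : -(d * (D + 2 * M)) ≤ deriv f t1 * d - f t1 + f t0 := by
      nlinarith [abs_le.1 (hD t1), abs_le.1 (hM t1), abs_le.1 (hM t0)]
    have key : -(1 / 2) ≤ 2 * (deriv f t1 * d - f t1 + f t0) / (g * d ^ 2) := by
      rw [le_div_iff₀ (by positivity)]
      nlinarith
    linarith
end

section
/- Let h : ℝ² → ℝ be a C³ function satisfying h(t₀ + 1, t₁ + 1) = h(t₀, t₁) for all (t₀, t₁), and suppose there exist k > 0 and ε < 0 such that ∂²h/∂t₀∂t₁ (t₀, t₁) ≤ ε whenever t₁ − t₀ ≥ k. Suppose moreover that the third partial derivatives ∂³h/∂t₀∂t₁∂t₁ and ∂³h/∂t₀∂t₀∂t₁ are bounded on ℝ². Then there exists a C² function h̃ : ℝ² → ℝ and a constant ε̃ < 0 such that: (i) h̃(t₀ + 1, t₁ + 1) = h̃(t₀, t₁) for all (t₀, t₁); (ii) ∂²h̃/∂t₀∂t₁ (t₀,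 t₁) ≤ ε̃ < 0 for all (t₀, t₁) ∈ ℝ²; (iii) h̃(t₀, t₁) = h(t₀, t₁) whenever t₁ − t₀ ≥ k. -/
/-- The mixed second partial derivative `∂²h/∂t₀∂t₁` of a function of two real variables. -/
noncomputable def mixedDeriv (h : ℝ → ℝ → ℝ) (t0 t1 : ℝ) : ℝ :=
  deriv (fun a : ℝ => deriv (fun b : ℝ => h a b) t1) t0

section MixedDeriv

variable {h : ℝ → ℝ → ℝ}

theorem hasDerivAt_snd_of_contDiff (hreg : ContDiff ℝ 2 (fun p : ℝ × ℝ => h p.1 p.2)) (a b : ℝ) :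
    HasDerivAt (fun b : ℝ => h a b) (fderiv ℝ (fun p : ℝ × ℝ => h p.1 p.2) (a, b) (0, 1)) b := by
  have hd := (hreg.differentiable (by norm_num) (a, b)).hasFDerivAt
  exact hd.comp_hasDerivAt b ((hasDerivAt_const b a).prodMk (hasDerivAt_id b))

theorem contDiff_fderiv_snd (hreg : ContDiff ℝ 2 (fun p : ℝ × ℝ => h p.1 p.2)) :
    ContDiff ℝ 1 (fun q : ℝ × ℝ => fderiv ℝ (fun p : ℝ × ℝ => h p.1 p.2) q (0, 1)) :=
  (hreg.fderiv_right (m := 1) (by norm_num)).clm_apply contDiff_const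

/-- The mixed derivative of a `C²` function is a genuine derivative. -/
theorem hasDerivAt_mixedDeriv (hreg : ContDiff ℝ 2 (fun p : ℝ × ℝ => h p.1 p.2)) (t0 t1 : ℝ) :
    HasDerivAt (fun a : ℝ => deriv (fun b : ℝ => h a b) t1) (mixedDeriv h t0 t1) t0 := by
  refine DifferentiableAt.hasDerivAt ?_
  simp only [(hasDerivAt_snd_of_contDiff hreg _ _).deriv]
  exact ((contDiff_fderiv_snd hreg).differentiable one_ne_zero (t0, t1)).comp t0
    (f := fun a : ℝ => (a, t1)) (by fun_prop)

theorem continuous_mixedDeriv (hreg : ContDiff ℝ 2 (fun p : ℝ × ℝ => h p.1 p.2)) :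
    Continuous (fun p : ℝ × ℝ => mixedDeriv h p.1 p.2) := by
  have key : ∀ p : ℝ × ℝ, mixedDeriv h p.1 p.2 =
      fderiv ℝ (fun q : ℝ × ℝ => fderiv ℝ (fun p : ℝ × ℝ => h p.1 p.2) q (0, 1)) p (1, 0) := by
    rintro ⟨t0, t1⟩
    have hd := ((contDiff_fderiv_snd hreg).differentiable one_ne_zero (t0, t1)).hasFDerivAt
    simp only [mixedDeriv, (hasDerivAt_snd_of_contDiff hreg _ _).deriv]
    exact (hd.comp_hasDerivAt t0 ((hasDerivAt_id t0).prodMk (hasDerivAt_const t0 t1))).deriv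
  simp only [key]
  exact ((contDiff_fderiv_snd hreg).continuous_fderiv one_ne_zero).clm_apply continuous_const

theorem mixedDeriv_add_one (hper : ∀ t0 t1 : ℝ, h (t0 + 1) (t1 + 1) = h t0 t1) (t0 t1 : ℝ) :
    mixedDeriv h (t0 + 1) (t1 + 1) = mixedDeriv h t0 t1 := by
  unfold mixedDeriv
  rw [← deriv_comp_add_const]
  congr 1
  funext a
  rw [← deriv_comp_add_const]
  simp only [hper]

/-- Adding a function of `t₁ - t₀` shifts the mixed derivative by its second derivative. -/
theorem mixedDeriv_add_comp_sub (hreg : ContDiff ℝ 2 (fun p : ℝ × ℝ => h p.1 p.2))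
    {φ ψ w : ℝ → ℝ} (hφ : ∀ s, HasDerivAt φ (ψ s) s) (hψ : ∀ s, HasDerivAt ψ (w s) s)
    (t0 t1 : ℝ) :
    mixedDeriv (fun a b => h a b + φ (b - a)) t0 t1 = mixedDeriv h t0 t1 - w (t1 - t0) := by
  have h1 : ∀ a, deriv (fun b => h a b + φ (b - a)) t1 =
      deriv (fun b => h a b) t1 + ψ (t1 - a) := fun a =>
    ((hasDerivAt_snd_of_contDiff hreg a t1).differentiableAt.hasDerivAt.add
      ((hφ (t1 - a)).comp_sub_const t1 a)).deriv
  unfold mixedDeriv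
  simp only [h1]
  have h2 := (hasDerivAt_mixedDeriv hreg t0 t1).add ((hψ (t1 - t0)).comp_const_sub t1 t0)
  exact h2.deriv.trans (sub_eq_add_neg _ _).symm

/-- A continuous function on the plane, invariant under the diagonal translation by `1`, is
bounded above on each diagonal by a continuous function `m`; moreover `m` inherits
upper bounds of the function along each diagonal. -/
theorem exists_continuous_diagonal_bound {d : ℝ → ℝ → ℝ}
    (hd : Continuous (fun p : ℝ × ℝ => d p.1 p.2))
    (hper : ∀ t0 t1 : ℝ, d (t0 + 1) (t1 + 1) = d t0 t1) :
    ∃ m : ℝ → ℝ, Continuous m ∧ (∀ t0 t1, d t0 t1 ≤ m (t1 - t0)) ∧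
      ∀ s c, (∀ t, d t (t + s) ≤ c) → m s ≤ c := by
  have hc : Continuous (fun p : ℝ × ℝ => d p.2 (p.2 + p.1)) :=
    hd.comp (f := fun p : ℝ × ℝ => (p.2, p.2 + p.1)) (by fun_prop)
  refine ⟨fun s => sSup ((fun t => d t (t + s)) '' Set.Icc 0 1),
    isCompact_Icc.continuous_sSup (f := fun s t => d t (t + s)) hc, fun t0 t1 => ?_,
    fun s c hs => csSup_le ((Set.nonempty_Icc.2 zero_le_one).image _) ?_⟩
  · have hp : Function.Periodic (fun t => d t (t + (t1 - t0))) 1 := fun t => by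
      simp only [add_right_comm t 1, hper]
    obtain ⟨y, hy, hy'⟩ := hp.exists_mem_Ico₀ one_pos t0
    simp only [add_sub_cancel] at hy'
    rw [hy']
    refine le_csSup ?_ ⟨y, Set.Ico_subset_Icc_self hy, rfl⟩
    exact (isCompact_Icc.image
      (hc.comp (f := fun t : ℝ => (t1 - t0, t)) (by fun_prop))).bddAbove
  · rintro _ ⟨t, -, rfl⟩
    exact hs t

end MixedDeriv

/-- A continuous function vanishing on `[k, ∞)` has a second antiderivative vanishing there. -/
theorem exists_second_antideriv_eq_zero {w : ℝ → ℝ} (hw : Continuous w) {k : ℝ}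
    (hk : ∀ s, k ≤ s → w s = 0) :
    ∃ φ ψ : ℝ → ℝ, (∀ s, HasDerivAt φ (ψ s) s) ∧ (∀ s, HasDerivAt ψ (w s) s) ∧
      ContDiff ℝ 2 φ ∧ ∀ s, k ≤ s → φ s = 0 := by
  have antideriv : ∀ {v : ℝ → ℝ}, Continuous v → (∀ s, k ≤ s → v s = 0) →
      ∃ u : ℝ → ℝ, (∀ s, HasDerivAt u (v s) s) ∧ ∀ s, k ≤ s → u s = 0 := by
    intro v hv hvk
    refine ⟨fun s => ∫ x in k..s, v x, fun s => hv.integral_hasStrictDerivAt k s |>.hasDerivAt,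
      fun s hs => ?_⟩
    refine intervalIntegral.integral_zero_ae (Filter.Eventually.of_forall fun x hx => hvk x ?_)
    rw [Set.uIoc_of_le hs] at hx
    exact hx.1.le
  obtain ⟨ψ, hψ, hψk⟩ := antideriv hw hk
  have hψc : ContDiff ℝ 1 ψ := contDiff_one_iff_deriv.2
    ⟨fun s => (hψ s).differentiableAt, by rwa [funext fun s => (hψ s).deriv]⟩
  obtain ⟨φ, hφ, hφk⟩ := antideriv hψc.continuous hψk
  refine ⟨φ, ψ, hφ, hψ, ?_, hφk⟩
  rw [show (2 : WithTop ℕ∞) = 1 + 1 by norm_num, contDiff_succ_iff_deriv]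
  refine ⟨fun s => (hφ s).differentiableAt, by simp, ?_⟩
  rwa [funext fun s => (hφ s).deriv]

/-- Proposition 2 of the paper: a `C³` generating function satisfying the diagonal
periodicity (H2), the twist condition `∂²h/∂t₀∂t₁ ≤ ε < 0` on the half-plane
`t₁ - t₀ ≥ k`, and with bounded third partials `∂³h/∂t₀∂t₁∂t₁`, `∂³h/∂t₀∂t₀∂t₁`,
can be modified to a `C²` function satisfying (H1), (H2) and the uniform twist
condition (H3) on all of `ℝ²`, coinciding with `h` on the half-plane `t₁ - t₀ ≥ k`. -/
theorem extension_of_generating_function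
    (h : ℝ → ℝ → ℝ) (hreg : ContDiff ℝ 3 (fun p : ℝ × ℝ => h p.1 p.2))
    (hper : ∀ t0 t1 : ℝ, h (t0 + 1) (t1 + 1) = h t0 t1)
    (k : ℝ) (hk : 0 < k) (ε : ℝ) (hε : ε < 0)
    (htwist : ∀ t0 t1 : ℝ, k ≤ t1 - t0 → mixedDeriv h t0 t1 ≤ ε)
    (M : ℝ)
    (hbd1 : ∀ t0 t1 : ℝ,
      |deriv (fun a : ℝ => deriv (fun b : ℝ => deriv (fun c : ℝ => h a c) b) t1) t0| ≤ M)
    (hbd2 : ∀ t0 t1 : ℝ,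
      |deriv (fun a : ℝ => deriv (fun a' : ℝ => deriv (fun c : ℝ => h a' c) t1) a) t0| ≤ M) :
    ∃ htil : ℝ → ℝ → ℝ, ∃ εtil : ℝ, εtil < 0 ∧
      ContDiff ℝ 2 (fun p : ℝ × ℝ => htil p.1 p.2) ∧
      (∀ t0 t1 : ℝ, htil (t0 + 1) (t1 + 1) = htil t0 t1) ∧
      (∀ t0 t1 : ℝ, mixedDeriv htil t0 t1 ≤ εtil) ∧
      (∀ t0 t1 : ℝ, k ≤ t1 - t0 → htil t0 t1 = h t0 t1) := by
  have hreg2 : ContDiff ℝ 2 (fun p : ℝ × ℝ => h p.1 p.2) := hreg.of_le (by norm_num)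
  obtain ⟨m, hmc, hle, hm⟩ :=
    exists_continuous_diagonal_bound (continuous_mixedDeriv hreg2) (mixedDeriv_add_one hper)
  obtain ⟨φ, ψ, hφ, hψ, hφ2, hφk⟩ := exists_second_antideriv_eq_zero
    (w := fun s => max (m s - ε) 0) (k := k) (by fun_prop) fun s hs =>
      max_eq_right (sub_nonpos.2 (hm s ε fun t => htwist t (t + s) (by simpa using hs)))
  refine ⟨fun a b => h a b + φ (b - a), ε, hε, ?_, fun t0 t1 => ?_, fun t0 t1 => ?_,
    fun t0 t1 hs => ?_⟩
  · exact hreg2.add (hφ2.comp (contDiff_snd.sub contDiff_fst))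
  · simp only [hper, add_sub_add_right_eq_sub]
  · rw [mixedDeriv_add_comp_sub hreg2 hφ hψ]
    linarith [hle t0 t1, le_max_left (m (t1 - t0) - ε) 0]
  · simp only [hφk _ hs, add_zero]
end

section
/- Let d : ℝ² → ℝ be a C¹ function, let k > 0, ε < 0 with d(t₀, t₁) ≤ ε whenever t₁ − t₀ ≥ k, and suppose ∂d/∂t₀ and ∂d/∂t₁ are bounded. Fix ε̃ with ε < ε̃ < 0, set A = ε̃ − ε, C = (1/2)·‖∂_{t₁}d − ∂_{t₀}d‖_∞, let I = inf_{x < k} (A + C·(x − k))/(x − k)², and choose H < I. Define, for t₁ − t₀ < k, D(t₀, t₁) = d((t₀ + t₁ − k)/2, (t₀ + t₁ + k)/2) + (1/2)·(∂_{t₁}d(t₀, t₁) − ∂_{t₀}d(t₀, t₁))·(t₁ − t₀ − k) + H·(t₁ − t₀ − k)². Then D(t₀, t₁) ≤ ε̃ < 0 for all (t₀, t₁) with t₁ − t₀ < k. -/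
theorem bddBelow_image_affine_div_sq {A : ℝ} (hA : 0 < A) (C k : ℝ) :
    BddBelow ((fun x : ℝ => (A + C * (x - k)) / (x - k) ^ 2) '' Set.Iio k) := by
  refine ⟨-(C ^ 2 / (4 * A)), ?_⟩
  rintro _ ⟨x, hx, rfl⟩
  have hx2 : 0 < (x - k) ^ 2 := sq_pos_of_neg (sub_neg.2 hx)
  rw [le_div_iff₀ hx2]
  have hsq : A + C * (x - k) - -(C ^ 2 / (4 * A)) * (x - k) ^ 2
      = (2 * A + C * (x - k)) ^ 2 / (4 * A) := by
    field_simp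
    ring
  have hnonneg : 0 ≤ (2 * A + C * (x - k)) ^ 2 / (4 * A) := by positivity
  linarith

/-- The key estimate (15): the quadratic modification `D` of the mixed second derivative
stays `≤ ε̃ < 0` on the region `t₁ - t₀ < k`. -/
theorem extension_formula_negative
    (d : ℝ → ℝ → ℝ) (hd : ContDiff ℝ 1 (fun p : ℝ × ℝ => d p.1 p.2))
    (k : ℝ) (hk : 0 < k) (ε : ℝ) (hε : ε < 0)
    (htwist : ∀ t0 t1 : ℝ, k ≤ t1 - t0 → d t0 t1 ≤ ε)
    (hbdd : BddAbove (Set.range fun p : ℝ × ℝ =>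
      |deriv (fun b : ℝ => d p.1 b) p.2 - deriv (fun a : ℝ => d a p.2) p.1|))
    (εtil : ℝ) (hεtil1 : ε < εtil) (hεtil2 : εtil < 0)
    (A C I H : ℝ)
    (hA : A = εtil - ε)
    (hC : C = (1 / 2) * sSup (Set.range fun p : ℝ × ℝ =>
      |deriv (fun b : ℝ => d p.1 b) p.2 - deriv (fun a : ℝ => d a p.2) p.1|))
    (hI : I = sInf ((fun x : ℝ => (A + C * (x - k)) / (x - k) ^ 2) '' Set.Iio k))
    (hH : H < I) :
    ∀ t0 t1 : ℝ, t1 - t0 < k →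
      d ((t0 + t1 - k) / 2) ((t0 + t1 + k) / 2)
        + (1 / 2) * (deriv (fun b : ℝ => d t0 b) t1 - deriv (fun a : ℝ => d a t1) t0)
          * (t1 - t0 - k)
        + H * (t1 - t0 - k) ^ 2 ≤ εtil := by
  intro t0 t1 ht
  have hA0 : 0 < A := by linarith
  have hu : t1 - t0 - k < 0 := by linarith
  have hfirst : d ((t0 + t1 - k) / 2) ((t0 + t1 + k) / 2) ≤ ε :=
    htwist _ _ (by linarith)
  have hderiv : (1 / 2) * |deriv (fun b : ℝ => d t0 b) t1 - deriv (fun a : ℝ => d a t1) t0|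
      ≤ C := by
    rw [hC]
    gcongr
    exact le_csSup hbdd ⟨(t0, t1), rfl⟩
  have hsecond : (1 / 2) * (deriv (fun b : ℝ => d t0 b) t1 - deriv (fun a : ℝ => d a t1) t0)
      * (t1 - t0 - k) ≤ -C * (t1 - t0 - k) := by
    refine mul_le_mul_of_nonpos_right ?_ hu.le
    linarith [neg_abs_le (deriv (fun b : ℝ => d t0 b) t1 - deriv (fun a : ℝ => d a t1) t0)]
  have hthird : H * (t1 - t0 - k) ^ 2 ≤ A + C * (t1 - t0 - k) := by
    rw [← le_div_iff₀ (sq_pos_of_neg hu)]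
    refine hH.le.trans ?_
    rw [hI]
    exact csInf_le (bddBelow_image_affine_div_sq hA0 C k) ⟨t1 - t0, ht, rfl⟩
  linarith
end
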